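/- Let f : G → H be a homomorphism of countable groups. Then asdim G ≤ asdim H + asdim (ker f), where asymptotic dimensions are computed with respect to left-invariant proper metrics on the groups. -/

import Mathlib

open Set Filter Pointwise

section Defs

variable {X Y G H : Type*}

/-- `d` is a metric on `X`. -/
def IsMetric (d : X → X → ℝ) : Prop :=
  (∀ x y, 0 ≤ d x y) ∧ (∀ x y, d x y = 0 ↔ x = y) ∧ (∀ x y, d x y = d y x) ∧
    (∀ x y z, d x z ≤ d x y + d y z)

/-- `d` is a left-invariant metric on the group `G`. -/
def IsLeftInvariant [Group G] (d : G → G → ℝ) : Prop :=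
  ∀ g x y : G, d (g * x) (g * y) = d x y

/-- `d` is proper: closed balls are compact, where a countable group is regarded as a
discrete topological space. -/
def IsProperMetric (d : G → G → ℝ) : Prop :=
  ∀ (x : G) (r : ℝ), @IsCompact G ⊥ {y | d x y ≤ r}

/-- The (left) defect set `D(f) = {f(y)⁻¹ f(x)⁻¹ f(xy) | x y ∈ G}` of a map between groups. -/
def defectSet [Group G] [Group H] (f : G → H) : Set H :=
  {h | ∃ x y : G, h = (f y)⁻¹ * (f x)⁻¹ * f (x * y)}

/-- `f` is a quasimorphism if its defect set is finite. -/
def IsQuasimorphism [Group G] [Group H] (f : G → H) : Prop :=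
  (defectSet f).Finite

/-- `f` is symmetric: `f(a⁻¹) = f(a)⁻¹`. -/
def IsSymmetricMap [Group G] [Group H] (f : G → H) : Prop :=
  ∀ a : G, f a⁻¹ = (f a)⁻¹

/-- `f` is unital: `f(e) = e`. -/
def IsUnitalMap [Group G] [Group H] (f : G → H) : Prop :=
  f 1 = 1

/-- `Λ` is an approximate subgroup of `G`: symmetric, unital and `Λ² ⊆ ΛF` for a finite `F`. -/
def IsApproxSubgroup [Group G] (Λ : Set G) : Prop :=
  Λ⁻¹ = Λ ∧ (1 : G) ∈ Λ ∧ ∃ F : Set G, F.Finite ∧ Λ * Λ ⊆ Λ * F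

/-- The subset `s` of `X` has asymptotic dimension at most `n`, with respect to the
(restriction of the) metric `d`: for every `R > 0` there is a cover of `s` by subsets of `s`,
uniformly bounded by some `D > 0`, splitting into `n + 1` `R`-disjoint families. -/
def ASDimLE (d : X → X → ℝ) (s : Set X) (n : ℕ) : Prop :=
  ∀ R : ℝ, 0 < R → ∃ D : ℝ, 0 < D ∧ ∃ 𝒰 : Fin (n + 1) → Set (Set X),
    (∀ i, ∀ u ∈ 𝒰 i, u ⊆ s) ∧
    (s ⊆ ⋃ i, ⋃₀ 𝒰 i) ∧
    (∀ i, ∀ u ∈ 𝒰 i, ∀ x ∈ u, ∀ y ∈ u, d x y ≤ D) ∧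
    (∀ i, ∀ u ∈ 𝒰 i, ∀ v ∈ 𝒰 i, u ≠ v → ∀ x ∈ u, ∀ y ∈ v, R ≤ d x y)

/-- The asymptotic dimension of the subset `s` of `X` with respect to the metric `d`,
as an element of `ℕ∞` (`⊤` means infinite asymptotic dimension). -/
noncomputable def asdim (d : X → X → ℝ) (s : Set X) : ℕ∞ :=
  sInf ((fun n : ℕ => (n : ℕ∞)) '' {n | ASDimLE d s n})

/-- A family `𝒴` of subsets of `X` has asymptotic dimension uniformly bounded by `n`: for
every `R > 0` there is a common `D > 0` such that every member admits a `D`-bounded cover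
splitting into `n + 1` `R`-disjoint families. -/
def ASDimUnifLE {ι : Type*} (d : X → X → ℝ) (𝒴 : ι → Set X) (n : ℕ) : Prop :=
  ∀ R : ℝ, 0 < R → ∃ D : ℝ, 0 < D ∧ ∀ α : ι, ∃ 𝒰 : Fin (n + 1) → Set (Set X),
    (∀ i, ∀ u ∈ 𝒰 i, u ⊆ 𝒴 α) ∧
    (𝒴 α ⊆ ⋃ i, ⋃₀ 𝒰 i) ∧
    (∀ i, ∀ u ∈ 𝒰 i, ∀ x ∈ u, ∀ y ∈ u, d x y ≤ D) ∧
    (∀ i, ∀ u ∈ 𝒰 i, ∀ v ∈ 𝒰 i, u ≠ v → ∀ x ∈ u, ∀ y ∈ v, R ≤ d x y)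

/-- `f` is coarsely Lipschitz on the subset `s`. -/
def IsCoarselyLipschitzOn (dX : X → X → ℝ) (dY : Y → Y → ℝ) (s : Set X) (f : X → Y) : Prop :=
  ∃ Φ : ℝ → ℝ, (∀ t, 0 ≤ t → 0 ≤ Φ t) ∧ MonotoneOn Φ (Ici (0 : ℝ)) ∧
    Tendsto Φ atTop atTop ∧ ∀ x ∈ s, ∀ x' ∈ s, dY (f x) (f x') ≤ Φ (dX x x')

/-- `f` is coarsely Lipschitz: `d_Y(f x, f x') ≤ Φ₊(d_X(x, x'))` for a non-decreasing
`Φ₊ : [0,∞) → [0,∞)` tending to `∞`. -/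
def IsCoarselyLipschitz (dX : X → X → ℝ) (dY : Y → Y → ℝ) (f : X → Y) : Prop :=
  ∃ Φ : ℝ → ℝ, (∀ t, 0 ≤ t → 0 ≤ Φ t) ∧ MonotoneOn Φ (Ici (0 : ℝ)) ∧
    Tendsto Φ atTop atTop ∧ ∀ x x' : X, dY (f x) (f x') ≤ Φ (dX x x')

/-- `f` is a coarse equivalence from `(s, dX)` to `(t, dY)`: a coarse embedding whose image
is coarsely dense in `t`. -/
def IsCoarseEquivOn (dX : X → X → ℝ) (dY : Y → Y → ℝ) (s : Set X) (t : Set Y) (f : X → Y) :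
    Prop :=
  MapsTo f s t ∧
  (∃ Φm Φp : ℝ → ℝ, (∀ u, 0 ≤ u → 0 ≤ Φm u) ∧ (∀ u, 0 ≤ u → 0 ≤ Φp u) ∧
    MonotoneOn Φm (Ici (0 : ℝ)) ∧ MonotoneOn Φp (Ici (0 : ℝ)) ∧
    Tendsto Φm atTop atTop ∧ Tendsto Φp atTop atTop ∧
    ∀ x ∈ s, ∀ x' ∈ s,
      Φm (dX x x') ≤ dY (f x) (f x') ∧ dY (f x) (f x') ≤ Φp (dX x x')) ∧
  ∃ L : ℝ, 0 < L ∧ ∀ y ∈ t, ∃ x ∈ s, dY y (f x) < L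

/-- `f : (X, dX) → (Y, dY)` is a coarse equivalence. -/
def IsCoarseEquiv (dX : X → X → ℝ) (dY : Y → Y → ℝ) (f : X → Y) : Prop :=
  IsCoarseEquivOn dX dY univ univ f

end Defs

section Helpers

open Relation

def HStep {X : Type*} (d : X → X → ℝ) (A : Set X) (R : ℝ) (x y : X) : Prop :=
  x ∈ A ∧ y ∈ A ∧ d x y < R

def HBdd {X : Type*} (d : X → X → ℝ) (A : Set X) (R D : ℝ) : Prop :=
  ∀ x y, ReflTransGen (HStep d A R) x y → d x y ≤ D

lemma HBdd.mono {X : Type*} {d : X → X → ℝ} {A A' : Set X} {R R' D D' : ℝ}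
    (h : HBdd d A R D) (hA : A' ⊆ A) (hR : R' ≤ R) (hD : D ≤ D') : HBdd d A' R' D' := by
  intro x y hxy
  refine (h x y (ReflTransGen.mono (p := HStep d A R) ?_ x y hxy)).trans hD
  rintro a b ⟨ha, hb, hab⟩
  exact ⟨hA ha, hA hb, hab.trans_le hR⟩

lemma HBdd.nonneg {X : Type*} {d : X → X → ℝ} (hd : IsMetric d) {A : Set X} {R D : ℝ} (x : X)
    (h : HBdd d A R D) : 0 ≤ D :=
  (hd.1 x x).trans (h x x ReflTransGen.refl)

lemma HStep.symm {X : Type*} {d : X → X → ℝ} (hd : IsMetric d) (A : Set X) (R : ℝ) :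
    ∀ x y, ReflTransGen (HStep d A R) x y → ReflTransGen (HStep d A R) y x := by
  intro x y h
  induction h with
  | refl => exact ReflTransGen.refl
  | tail _ h ih => exact ReflTransGen.head ⟨h.2.1, h.1, by rw [hd.2.2.1]; exact h.2.2⟩ ih

/-- neighbourhoods -/
lemma HBdd.nbhd {X : Type*} {d : X → X → ℝ} (hd : IsMetric d) {A A' : Set X} {R D L : ℝ}
    (hL : 0 ≤ L) (h : HBdd d A (R + 2 * L) D) (hA : ∀ x ∈ A', ∃ a ∈ A, d x a ≤ L) :
    HBdd d A' R (D + 2 * L) := by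
  obtain ⟨h0, h1, h2, h3⟩ := hd
  intro x y hxy
  have key : x = y ∨ ∃ a b, d x a ≤ L ∧ d y b ≤ L ∧ b ∈ A ∧ y ∈ A' ∧
      ReflTransGen (HStep d A (R + 2 * L)) a b := by
    induction hxy with
    | refl => exact Or.inl rfl
    | @tail y z _ hyz ih =>
      right
      obtain ⟨c, hc, hzc⟩ := hA z hyz.2.1
      rcases ih with rfl | ⟨a, b, hxa, hyb, hb, hy, hab⟩
      · obtain ⟨a, ha, hxa⟩ := hA x hyz.1
        refine ⟨a, c, hxa, hzc, hc, hyz.2.1, ReflTransGen.single ⟨ha, hc, ?_⟩⟩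
        have := h3 a x c
        have := h3 x z c
        have := hyz.2.2
        have := h2 x a
        linarith
      · refine ⟨a, c, hxa, hzc, hc, hyz.2.1, hab.tail ⟨hb, hc, ?_⟩⟩
        have := h3 b y c
        have := h3 y z c
        have := hyz.2.2
        have := h2 y b
        linarith
  rcases key with rfl | ⟨a, b, hxa, hyb, -, -, hab⟩
  · have := h x x ReflTransGen.refl
    linarith
  · have := h a b hab
    have := h3 x a y
    have := h3 a b y
    have := h2 y b
    linarith

/-- saturated unions -/
lemma HBdd.union {X : Type*} {d : X → X → ℝ} (hd : IsMetric d) {P Q : Set X} {r D E : ℝ}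
    (hr : 0 < r) (hP : HBdd d P r D) (hQ : HBdd d Q (D + 2 * r) E) :
    HBdd d (P ∪ Q) r (E + 2 * (D + r)) := by
  intro x y hxy
  have hD : 0 ≤ D := hP.nonneg hd x
  have hE : 0 ≤ E := hQ.nonneg hd x
  obtain ⟨h0, h1, h2, h3⟩ := hd
  have hxx : ∀ x, d x x = 0 := fun x => (h1 x x).2 rfl
  have key : x = y ∨ (y ∈ P ∧ ReflTransGen (HStep d P r) x y) ∨
      ∃ q q', d x q ≤ D + r ∧ q' ∈ Q ∧ ReflTransGen (HStep d Q (D + 2 * r)) q q' ∧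
        (y = q' ∨ (y ∈ P ∧ ∃ p, d q' p < r ∧ ReflTransGen (HStep d P r) p y)) := by
    induction hxy with
    | refl => exact Or.inl rfl
    | @tail y z _ hyz ih =>
      right
      obtain ⟨hy, hz, hyz⟩ := hyz
      rcases hz with hz | hz
      · -- z in P
        rcases ih with rfl | ⟨hyP, hch⟩ | ⟨q, q', hxq, hq', hch, rfl | ⟨hyP, p, hp, hpc⟩⟩
        · rcases hy with hy | hy
          · exact Or.inl ⟨hz, ReflTransGen.single ⟨hy, hz, hyz⟩⟩
          · right
            refine ⟨x, x, ?_, hy, ReflTransGen.refl, Or.inr ⟨hz, z, hyz, ReflTransGen.refl⟩⟩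
            rw [hxx]; linarith
        · exact Or.inl ⟨hz, hch.tail ⟨hyP, hz, hyz⟩⟩
        · right
          exact ⟨q, y, hxq, hq', hch, Or.inr ⟨hz, z, hyz, ReflTransGen.refl⟩⟩
        · right
          exact ⟨q, q', hxq, hq', hch, Or.inr ⟨hz, p, hp, hpc.tail ⟨hyP, hz, hyz⟩⟩⟩
      · right
        rcases ih with rfl | ⟨hyP, hch⟩ | ⟨q, q', hxq, hq', hch, rfl | ⟨hyP, p, hp, hpc⟩⟩
        · exact ⟨z, z, by linarith, hz, ReflTransGen.refl, Or.inl rfl⟩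
        · refine ⟨z, z, ?_, hz, ReflTransGen.refl, Or.inl rfl⟩
          have := hP _ _ hch
          have := h3 x y z
          linarith
        · exact ⟨q, z, hxq, hz, hch.tail ⟨hq', hz, by linarith⟩, Or.inl rfl⟩
        · refine ⟨q, z, hxq, hz, hch.tail ⟨hq', hz, ?_⟩, Or.inl rfl⟩
          have := hP _ _ hpc
          have := h3 q' p z
          have := h3 p y z
          linarith
  rcases key with rfl | ⟨hyP, hch⟩ | ⟨q, q', hxq, hq', hch, rfl | ⟨hyP, p, hp, hpc⟩⟩
  · rw [hxx]; linarith
  · have := hP _ _ hch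
    linarith
  · have := hQ _ _ hch
    have := h3 x q y
    linarith
  · have := hQ _ _ hch
    have := hP _ _ hpc
    have := h3 x q y
    have := h3 q q' y
    have := h3 q' p y
    linarith

/-- The `N`-colour version, with every point of `s` in at least `N - n` colours. -/
def HCol {X : Type*} (d : X → X → ℝ) (s : Set X) (n N : ℕ) : Prop :=
  ∀ R : ℝ, 0 < R → ∃ D : ℝ, ∃ A : Fin N → Set X, (∀ i, HBdd d (A i) R D) ∧
    ∀ x ∈ s, N ≤ n + {i | x ∈ A i}.ncard

lemma HCol.of_asdimLE {X : Type*} {d : X → X → ℝ} (hd : IsMetric d) {s : Set X} {n : ℕ}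
    (h : ASDimLE d s n) : HCol d s n (n + 1) := by
  intro R hR
  obtain ⟨D, hD, U, hU1, hU2, hU3, hU4⟩ := h R hR
  refine ⟨D, fun i => ⋃₀ U i, ?_, ?_⟩
  · intro i x y hxy
    have key : x = y ∨ ∃ u ∈ U i, x ∈ u ∧ y ∈ u := by
      induction hxy with
      | refl => exact Or.inl rfl
      | @tail y z _ hyz ih =>
        right
        obtain ⟨⟨u, hu, hyu⟩, ⟨v, hv, hzv⟩, hyz⟩ := hyz
        have aux : ∀ w ∈ U i, y ∈ w → z ∈ w := by
          intro w hw hyw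
          by_contra hzw
          have hne : w ≠ v := by
            rintro rfl
            exact hzw hzv
          have := hU4 i w hw v hv hne y hyw z hzv
          linarith
        rcases ih with rfl | ⟨w, hw, hxw, hyw⟩
        · exact ⟨u, hu, hyu, aux u hu hyu⟩
        · exact ⟨w, hw, hxw, aux w hw hyw⟩
    rcases key with rfl | ⟨u, hu, hx, hy⟩
    · rw [(hd.2.1 x x).2 rfl]; exact hD.le
    · exact hU3 i u hu x hx y hy
  · intro x hx
    obtain ⟨i, hi⟩ := mem_iUnion.1 (hU2 hx)
    have : 0 < {i | x ∈ ⋃₀ U i}.ncard := (ncard_pos (toFinite _)).2 ⟨i, hi⟩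
    show n + 1 ≤ n + {i | x ∈ ⋃₀ U i}.ncard
    exact Nat.add_le_add_left this n

lemma asdimLE_of {X : Type*} {d : X → X → ℝ} (hd : IsMetric d) {n : ℕ}
    (h : ∀ R : ℝ, 0 < R → ∃ D : ℝ, ∃ A : Fin (n + 1) → Set X, (∀ i, HBdd d (A i) R D) ∧
      ∀ x, ∃ i, x ∈ A i) : ASDimLE d univ n := by
  intro R hR
  obtain ⟨D, A, hA, hc⟩ := h R hR
  refine ⟨max D 1, by positivity,
    fun i => {u | ∃ x ∈ A i, u = {y | y ∈ A i ∧ ReflTransGen (HStep d (A i) R) x y}},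
    fun _ _ _ => subset_univ _, ?_, ?_, ?_⟩
  · intro x _
    obtain ⟨i, hi⟩ := hc x
    exact mem_iUnion.2 ⟨i, _, ⟨x, hi, rfl⟩, hi, ReflTransGen.refl⟩
  · rintro i u ⟨z, hz, rfl⟩ x ⟨_, hx⟩ y ⟨_, hy⟩
    exact (hA i x y ((HStep.symm hd _ _ _ _ hx).trans hy)).trans (le_max_left _ _)
  · rintro i u ⟨a, ha, rfl⟩ v ⟨b, hb, rfl⟩ hne x ⟨hx, hax⟩ y ⟨hy, hby⟩
    by_contra hlt
    apply hne
    have hab : ReflTransGen (HStep d (A i) R) a b :=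
      (hax.tail ⟨hx, hy, not_le.1 hlt⟩).trans (HStep.symm hd _ _ _ _ hby)
    ext z
    exact ⟨fun hz => ⟨hz.1, (HStep.symm hd _ _ _ _ hab).trans hz.2⟩,
      fun hz => ⟨hz.1, hab.trans hz.2⟩⟩

/-- Kolmogorov trick -/
lemma HCol.succ {X : Type*} {d : X → X → ℝ} (hd : IsMetric d) {s : Set X} {n N : ℕ}
    (hN : n < N) (h : HCol d s n N) : HCol d s n (N + 1) := by
  intro R hR
  obtain ⟨D, A, hA, hc⟩ := h (R + 2 * R) (by linarith)
  let A' : Fin N → Set X := fun i => {x | ∃ a ∈ A i, d x a ≤ R}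
  have hAA' : ∀ i, A i ⊆ A' i := fun i x hx => ⟨x, hx, by rw [(hd.2.1 x x).2 rfl]; exact hR.le⟩
  let B : Set X := {x | x ∈ s ∧ n + {i | x ∈ A' i}.ncard ≤ N}
  have hBS : ∀ x ∈ B, {i | x ∈ A i} = {i | x ∈ A' i} := by
    intro x hx
    have hss : {i | x ∈ A i} ⊆ {i | x ∈ A' i} := fun i hi => hAA' i hi
    refine eq_of_subset_of_ncard_le hss ?_ (toFinite _)
    have := hc x hx.1
    have := hx.2
    omega
  have hBne : ∀ x ∈ B, ∃ i, x ∈ A i := by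
    intro x hx
    have := hc x hx.1
    have h0 : 0 < {i | x ∈ A i}.ncard := by omega
    exact (ncard_pos (toFinite _)).1 h0
  refine ⟨D + 2 * R, Fin.snoc (α := fun _ => Set X) A' B, ?_, ?_⟩
  · intro i
    refine Fin.lastCases ?_ (fun i => ?_) i
    · rw [Fin.snoc_last]
      intro x y hxy
      have key : x = y ∨ (∀ i, x ∈ A i → y ∈ A i ∧
          ReflTransGen (HStep d (A i) (R + 2 * R)) x y) ∧ x ∈ B := by
        induction hxy with
        | refl => exact Or.inl rfl
        | @tail y z _ hyz ih =>
          right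
          obtain ⟨hy, hz, hyz⟩ := hyz
          have aux : ∀ i, y ∈ A i → z ∈ A i := by
            intro i hi
            have : i ∈ {i | z ∈ A' i} := ⟨y, hi, by rw [hd.2.2.1]; exact hyz.le⟩
            rw [← hBS z hz] at this
            exact this
          rcases ih with rfl | ⟨ih, hx⟩
          · exact ⟨fun i hi => ⟨aux i hi, ReflTransGen.single ⟨hi, aux i hi, by linarith⟩⟩, hy⟩
          · refine ⟨fun i hi => ?_, hx⟩
            obtain ⟨h1, h2⟩ := ih i hi
            exact ⟨aux i h1, h2.tail ⟨h1, aux i h1, by linarith⟩⟩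
      rcases key with rfl | ⟨hk, hx⟩
      · have h0 : 0 < N := by omega
        have := hA ⟨0, h0⟩ x x ReflTransGen.refl
        linarith
      · obtain ⟨i, hi⟩ := hBne x hx
        have := hA i x y (hk i hi).2
        linarith
    · rw [Fin.snoc_castSucc]
      exact (hA i).nbhd hd hR.le (fun x hx => hx)
  · intro x hx
    set T : Set (Fin (N + 1)) := {i | x ∈ Fin.snoc (α := fun _ => Set X) A' B i} with hT
    have him : Fin.castSucc '' {i | x ∈ A' i} ⊆ T := by
      rintro _ ⟨i, hi, rfl⟩
      simpa [hT] using hi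
    have hcard : (Fin.castSucc '' {i | x ∈ A' i}).ncard = {i | x ∈ A' i}.ncard :=
      ncard_image_of_injective _ (Fin.castSucc_injective N)
    have hge : {i | x ∈ A i}.ncard ≤ {i | x ∈ A' i}.ncard :=
      ncard_le_ncard (fun i hi => hAA' i hi) (toFinite _)
    have := hc x hx
    by_cases hB : x ∈ B
    · have hlast : Fin.last N ∈ T := by simpa [hT] using hB
      have hss : insert (Fin.last N) (Fin.castSucc '' {i | x ∈ A' i}) ⊆ T :=
        insert_subset hlast him
      have h1 := ncard_le_ncard hss (toFinite _)
      rw [ncard_insert_of_notMem _ (toFinite _), hcard] at h1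
      · omega
      · rintro ⟨i, _, hi⟩
        exact (Fin.castSucc_lt_last i).ne hi
    · have h1 := ncard_le_ncard him (toFinite _)
      have h2 : ¬ (n + {i | x ∈ A' i}.ncard ≤ N) := fun h => hB ⟨hx, h⟩
      omega

lemma HCol.of_le {X : Type*} {d : X → X → ℝ} (hd : IsMetric d) {s : Set X} {n : ℕ}
    (h : ASDimLE d s n) (k : ℕ) : HCol d s n (n + 1 + k) := by
  induction k with
  | zero => exact HCol.of_asdimLE hd h
  | succ k ih => exact HCol.succ (N := n + 1 + k) hd (by omega) ih

lemma HCol.nbhd {X : Type*} {d : X → X → ℝ} (hd : IsMetric d) {s s' : Set X} {n N : ℕ} {L : ℝ}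
    (hL : 0 ≤ L) (h : HCol d s n N) (hs : ∀ x ∈ s', ∃ a ∈ s, d x a ≤ L) : HCol d s' n N := by
  intro R hR
  obtain ⟨D, A, hA, hc⟩ := h (R + 2 * L) (by linarith)
  refine ⟨D + 2 * L, fun i => {x | ∃ a ∈ A i, d x a ≤ L},
    fun i => (hA i).nbhd hd hL (fun x hx => hx), ?_⟩
  intro x hx
  obtain ⟨a, ha, hxa⟩ := hs x hx
  refine (hc a ha).trans (Nat.add_le_add_left (ncard_le_ncard ?_ (toFinite _)) n)
  intro i hi
  exact ⟨a, hi, hxa⟩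

lemma HBdd.translate {G : Type*} [Group G] {d : G → G → ℝ} (hl : IsLeftInvariant d)
    {A A' : Set G} {R D : ℝ} (h : HBdd d A R D) (g : G) (hA : ∀ x ∈ A', g⁻¹ * x ∈ A) :
    HBdd d A' R D := by
  intro x y hxy
  rw [← hl g⁻¹]
  apply h
  refine ReflTransGen.lift (p := HStep d A R) (fun x => g⁻¹ * x) ?_ x y hxy
  rintro a b ⟨ha, hb, hab⟩
  exact ⟨hA a ha, hA b hb, by rw [hl]; exact hab⟩

lemma ball_finite {G : Type*} {d : G → G → ℝ} (h : IsProperMetric d) (x : G) (r : ℝ) :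
    {y | d x y ≤ r}.Finite := by
  letI : TopologicalSpace G := ⊥
  haveI : DiscreteTopology G := ⟨rfl⟩
  exact (h x r).finite_of_discrete

lemma fibre_col {G H : Type*} [Group G] [Group H] {d : G → G → ℝ} (hd : IsMetric d)
    (hl : IsLeftInvariant d) {d' : H → H → ℝ} (hd' : IsMetric d') (hl' : IsLeftInvariant d')
    (f : G →* H) {W : Set H} {B C : ℝ} (hW : HBdd d' W (B + 1) C) {m N : ℕ}
    (hK : HCol d {x | d' 1 (f x) ≤ C} m N) (R : ℝ) (hR : 0 < R) :
    ∃ D : ℝ, ∃ c : Fin N → Set G, (∀ x, f x ∈ W → N ≤ m + {j | x ∈ c j}.ncard) ∧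
      ∀ j (u : Set H), (∀ a ∈ u, ∀ b ∈ u, d' a b ≤ B) →
        HBdd d (c j ∩ f ⁻¹' u ∩ f ⁻¹' W) R D := by
  obtain ⟨D, V, hV, hc⟩ := hK R hR
  let S : Setoid G :=
    { r := fun x y => ReflTransGen (HStep d' W (B + 1)) (f x) (f y)
      iseqv := ⟨fun _ => ReflTransGen.refl, fun h => HStep.symm hd' _ _ _ _ h,
        fun h h' => h.trans h'⟩ }
  let ρ : G → G := fun x => (Quotient.mk S x).out
  have hρ : ∀ x, ReflTransGen (HStep d' W (B + 1)) (f (ρ x)) (f x) := fun x =>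
    Quotient.exact (s := S) (Quotient.out_eq (Quotient.mk S x))
  have hρ2 : ∀ x y, ReflTransGen (HStep d' W (B + 1)) (f x) (f y) → ρ x = ρ y := by
    intro x y h
    have : Quotient.mk S x = Quotient.mk S y := Quotient.sound (s := S) h
    simp only [ρ, this]
  refine ⟨D, fun j => {x | (ρ x)⁻¹ * x ∈ V j}, ?_, ?_⟩
  · intro x hx
    refine hc ((ρ x)⁻¹ * x) ?_
    have := hW _ _ (hρ x)
    rw [← hl' (f (ρ x))⁻¹] at this
    simpa using this
  · intro j u hu
    by_cases hne : (f ⁻¹' u ∩ f ⁻¹' W).Nonempty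
    · obtain ⟨x0, hx0u, hx0W⟩ := hne
      refine (hV j).translate hl (ρ x0) ?_
      rintro x ⟨⟨hx, hxu⟩, hxW⟩
      have : ρ x0 = ρ x := by
        refine hρ2 _ _ (ReflTransGen.single ⟨hx0W, hxW, ?_⟩)
        have := hu _ hx0u _ hxu
        linarith
      rw [this]
      exact hx
    · refine (hV j).mono ?_ le_rfl le_rfl
      rintro x ⟨⟨hx, hxu⟩, hxW⟩
      exact absurd ⟨x, hxu, hxW⟩ hne

lemma glue_col {G H : Type*} [Group G] [Group H] {d : G → G → ℝ} (hd : IsMetric d)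
    (hl : IsLeftInvariant d) {d' : H → H → ℝ} (hd' : IsMetric d') (hl' : IsLeftInvariant d')
    (f : G →* H) {q : ℕ} (W : Fin q → Set H) {B C : ℝ} (hW : ∀ t, HBdd d' (W t) (B + 1) C)
    {m N : ℕ} (hK : HCol d {x | d' 1 (f x) ≤ C} m N) (r : ℝ) (hr : 0 < r) (p : ℕ) :
    ∃ D : ℝ, 0 ≤ D ∧ ∃ c : Fin N → Set G,
      (∀ x, (∃ t : Fin q, t.1 < p ∧ f x ∈ W t) → N ≤ m + {j | x ∈ c j}.ncard) ∧
      ∀ j (u : Set H), (∀ a ∈ u, ∀ b ∈ u, d' a b ≤ B) → HBdd d (c j ∩ f ⁻¹' u) r D := by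
  induction p with
  | zero =>
    refine ⟨0, le_rfl, fun _ => ∅, ?_, ?_⟩
    · rintro x ⟨t, ht, _⟩
      omega
    · intro j u _ x y hxy
      have : x = y := by
        induction hxy with
        | refl => rfl
        | tail _ h _ => exact absurd h.1.1 (notMem_empty _)
      rw [(hd.2.1 x y).2 this]
  | succ p ih =>
    obtain ⟨D, hD, c, hc1, hc2⟩ := ih
    by_cases hp : p < q
    · obtain ⟨E, e, he1, he2⟩ := fibre_col hd hl hd' hl' f (hW ⟨p, hp⟩) hK (D + 2 * r)
        (by linarith)
      refine ⟨max (E + 2 * (D + r)) 0, le_max_right _ _,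
        fun j => c j ∪ (e j ∩ f ⁻¹' (W ⟨p, hp⟩)), ?_, ?_⟩
      · rintro x ⟨t, ht, hx⟩
        rcases Nat.lt_succ_iff_lt_or_eq.1 ht with h | h
        · refine (hc1 x ⟨t, h, hx⟩).trans
            (Nat.add_le_add_left (ncard_le_ncard ?_ (toFinite _)) m)
          intro j hj
          exact Or.inl hj
        · have : t = ⟨p, hp⟩ := Fin.ext h
          subst this
          refine (he1 x hx).trans (Nat.add_le_add_left (ncard_le_ncard ?_ (toFinite _)) m)
          intro j hj
          exact Or.inr ⟨hj, hx⟩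
      · intro j u hu
        refine (HBdd.union hd hr (hc2 j u hu) (he2 j u hu)).mono ?_ le_rfl (le_max_left _ _)
        rintro x ⟨hx | hx, hxu⟩
        · exact Or.inl ⟨hx, hxu⟩
        · exact Or.inr ⟨⟨hx.1, hxu⟩, hx.2⟩
    · refine ⟨D, hD, c, ?_, hc2⟩
      rintro x ⟨t, ht, hx⟩
      exact hc1 x ⟨t, by have := t.2; omega, hx⟩

lemma hurewicz_aux {G H : Type*} [Group G] [Group H]
    (d : G → G → ℝ) (hd : IsMetric d) (hdli : IsLeftInvariant d) (hdp : IsProperMetric d)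
    (d' : H → H → ℝ) (hd' : IsMetric d') (hd'li : IsLeftInvariant d')
    (hd'p : IsProperMetric d')
    (f : G →* H) (n m : ℕ) (hH : ASDimLE d' univ n) (hk : ASDimLE d (f.ker : Set G) m) :
    ASDimLE d univ (n + m) := by
  apply asdimLE_of hd
  intro r hr
  -- control function of `f`
  obtain ⟨r', hr', hfr⟩ : ∃ r' : ℝ, 0 < r' ∧ ∀ x y, d x y < r → d' (f x) (f y) < r' := by
    obtain ⟨M, hM⟩ := ((ball_finite hdp 1 r).image (fun y => d' 1 (f y))).bddAbove
    refine ⟨max M 0 + 1, by positivity, fun x y hxy => ?_⟩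
    have h1 : d' 1 (f (x⁻¹ * y)) ≤ M := by
      refine hM ⟨x⁻¹ * y, ?_, rfl⟩
      have := hdli x⁻¹ x y
      simp only [inv_mul_cancel] at this
      simp only [mem_setOf_eq, this]
      exact hxy.le
    have h2 := hd'li (f x)⁻¹ (f x) (f y)
    simp only [inv_mul_cancel] at h2
    rw [← h2, ← map_inv, ← map_mul]
    have := le_max_left M 0
    linarith
  have hcH : HCol d' univ n (n + m + 1) := by
    have := HCol.of_le hd' hH m
    rwa [show n + 1 + m = n + m + 1 by omega] at this
  obtain ⟨B, A, hA, hAc⟩ := hcH r' hr'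
  have hB : 0 ≤ B := (hA 0).nonneg hd' 1
  obtain ⟨C, W, hW, hWc⟩ := HCol.of_asdimLE hd' hH (B + 1) (by linarith)
  have hK : HCol d {x | d' 1 (f x) ≤ C} m (n + m + 1) := by
    have hker : HCol d (f.ker : Set G) m (n + m + 1) := by
      have := HCol.of_le hd hk n
      rwa [show m + 1 + n = n + m + 1 by omega] at this
    -- lifts of the finitely many points of the ball
    let σ : H → G := Function.invFun f
    obtain ⟨M, hM⟩ := ((ball_finite hd'p 1 C).image (fun h => d 1 (σ h)⁻¹)).bddAbove
    refine HCol.nbhd hd (L := max M 0) (le_max_right _ _) hker ?_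
    intro x hx
    have hσ : f (σ (f x)) = f x := Function.invFun_eq ⟨x, rfl⟩
    refine ⟨x * (σ (f x))⁻¹, ?_, ?_⟩
    · simp [MonoidHom.mem_ker, hσ]
    · have := hdli x 1 (σ (f x))⁻¹
      rw [mul_one] at this
      rw [this]
      exact (hM ⟨f x, hx, rfl⟩).trans (le_max_left _ _)
  obtain ⟨D, hD, c, hc1, hc2⟩ := glue_col hd hdli hd' hd'li f W hW hK r hr (n + 1)
  refine ⟨D, fun j => c j ∩ f ⁻¹' (A j), ?_, ?_⟩
  · intro j x y hxy
    let u : Set H := {h | ReflTransGen (HStep d' (A j) r') (f x) h}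
    have hu : ∀ a ∈ u, ∀ b ∈ u, d' a b ≤ B := fun a ha b hb =>
      hA j a b ((HStep.symm hd' _ _ _ _ ha).trans hb)
    apply hc2 j u hu
    have key : f y ∈ u ∧ ReflTransGen (HStep d (c j ∩ f ⁻¹' u) r) x y := by
      induction hxy with
      | refl => exact ⟨ReflTransGen.refl, ReflTransGen.refl⟩
      | @tail y z _ hyz ih =>
        obtain ⟨hy, hz, hyz⟩ := hyz
        have hzu : f z ∈ u := ReflTransGen.tail ih.1 ⟨hy.2, hz.2, hfr _ _ hyz⟩
        exact ⟨hzu, ih.2.tail ⟨⟨hy.1, ih.1⟩, ⟨hz.1, hzu⟩, hyz⟩⟩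
    exact key.2
  · intro x
    have h1 := hAc (f x) (mem_univ _)
    have h2 : n + m + 1 ≤ m + {j | x ∈ c j}.ncard := by
      apply hc1
      have := hWc (f x) (mem_univ _)
      have h0 : 0 < {i | f x ∈ W i}.ncard := by omega
      obtain ⟨t, ht⟩ := (ncard_pos (toFinite _)).1 h0
      exact ⟨t, t.2, ht⟩
    by_contra hno
    have hdisj : Disjoint {j | x ∈ c j} {j | f x ∈ A j} := by
      rw [Set.disjoint_left]
      intro j hj hj'
      exact hno ⟨j, hj, hj'⟩
    have h3 := ncard_union_eq hdisj (toFinite _) (toFinite _)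
    have h4 := ncard_le_ncard (subset_univ ({j | x ∈ c j} ∪ {j | f x ∈ A j})) (toFinite _)
    rw [ncard_univ, Nat.card_eq_fintype_card, Fintype.card_fin] at h4
    omega

lemma asdim_spec {X : Type*} (d : X → X → ℝ) (s : Set X) :
    asdim d s = ⊤ ∨ ∃ n : ℕ, ASDimLE d s n ∧ asdim d s = n := by
  by_cases h : {n | ASDimLE d s n}.Nonempty
  · right
    obtain ⟨n, hn, h⟩ := csInf_mem (h.image (fun n : ℕ => (n : ℕ∞)))
    exact ⟨n, hn, h.symm⟩
  · left
    rw [not_nonempty_iff_eq_empty] at h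
    simp [asdim, h]

end Helpers

/-- Hurewicz-type formula for homomorphisms of countable groups:
`asdim G ≤ asdim H + asdim (ker f)`. -/
theorem hurewicz_of_monoidHom
    {G H : Type*} [Group G] [Group H] [Countable G] [Countable H]
    (d : G → G → ℝ) (hd : IsMetric d) (hdli : IsLeftInvariant d) (hdp : IsProperMetric d)
    (d' : H → H → ℝ) (hd' : IsMetric d') (hd'li : IsLeftInvariant d')
    (hd'p : IsProperMetric d')
    (f : G →* H) :
    asdim d (univ : Set G) ≤ asdim d' (univ : Set H) + asdim d (f.ker : Set G) := by
  rcases asdim_spec d' (univ : Set H) with h | ⟨n, hn, h⟩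
  · rw [h, top_add]; exact le_top
  rcases asdim_spec d (f.ker : Set G) with h' | ⟨m, hm, h'⟩
  · rw [h', add_top]; exact le_top
  rw [h, h']
  exact sInf_le ⟨n + m, hurewicz_aux d hd hdli hdp d' hd' hd'li hd'p f n m hn hm, by push_cast; rfl⟩
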